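/- For every word w over {L,R} and every d ∈ ℤ, P_w(d) = P_{w̄}(−d), where w̄ is the word obtained from w by interchanging the letters L and R. -/

import Mathlib

/-- The probability mass functions `P t` on ℤ, defined by
`P 1 = δ₀`, `P (2t) = P t`, `P (2t+1) d = ½ P (t+1) (d+1) + ½ P t (d-1)`. -/
noncomputable def P : ℕ → ℤ → ℝ
  | 0, _ => 0
  | 1, d => if d = 0 then 1 else 0
  | (n+2), d =>
      if h : (n + 2) % 2 = 0 then P ((n+2)/2) d
      else (1/2) * P ((n+2)/2 + 1) (d+1) + (1/2) * P ((n+2)/2) (d-1)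
  decreasing_by all_goals omega

/-- Letters of the alphabet. -/
inductive LR | L | R
deriving DecidableEq

/-- One step of the identification of words with odd integers: `L : t ↦ 2t-1`, `R : t ↦ 2t+1`. -/
def LRstep (t : ℕ) : LR → ℕ
  | LR.L => 2 * t - 1
  | LR.R => 2 * t + 1

/-- The odd integer associated to a word over `{L,R}`, starting from 3. -/
def hword (w : List LR) : ℕ := w.foldl LRstep 3

/-- Interchanging the letters `L` and `R`. -/
def swapLR : LR → LR
  | LR.L => LR.R
  | LR.R => LR.L

theorem P_one (d : ℤ) : P 1 d = if d = 0 then 1 else 0 := by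
  rw [P]

theorem P_two_mul (t : ℕ) (ht : 1 ≤ t) (d : ℤ) : P (2 * t) d = P t d := by
  obtain ⟨n, rfl⟩ : ∃ n, t = n + 1 := ⟨t - 1, by omega⟩
  have h : (2 * n + 2) / 2 = n + 1 := by omega
  rw [show 2 * (n + 1) = 2 * n + 2 by ring, P, dif_pos (by omega), h]

theorem P_two_mul_add_one (t : ℕ) (ht : 1 ≤ t) (d : ℤ) :
    P (2 * t + 1) d = (1 / 2) * P (t + 1) (d + 1) + (1 / 2) * P t (d - 1) := by
  obtain ⟨n, rfl⟩ : ∃ n, t = n + 1 := ⟨t - 1, by omega⟩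
  have h : (2 * n + 1 + 2) / 2 = n + 1 := by omega
  rw [show 2 * (n + 1) + 1 = 2 * n + 1 + 2 by ring, P, dif_neg (by omega), h]

/-- `P` is reflected when its index is reflected within a dyadic interval `[2 ^ k, 2 ^ (k + 1)]`. -/
theorem P_reflect_dyadic (k : ℕ) : ∀ (t s : ℕ) (d : ℤ), 2 ^ k ≤ t → t ≤ 2 ^ (k + 1) →
    t + s = 3 * 2 ^ k → P t d = P s (-d) := by
  induction k with
  | zero =>
    intro t s d h1 h2 h3
    have h : P 2 = P 1 := funext fun d => P_two_mul 1 le_rfl d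
    obtain ⟨rfl, rfl⟩ | ⟨rfl, rfl⟩ : (t = 1 ∧ s = 2) ∨ (t = 2 ∧ s = 1) := by omega
    all_goals simp [h, P_one]
  | succ k ih =>
    intro t s d h1 h2 h3
    have hk : 1 ≤ 2 ^ k := Nat.one_le_two_pow
    simp only [pow_succ] at h1 h2 h3 ih
    obtain ⟨u, rfl | rfl⟩ := Nat.even_or_odd' t
    · obtain ⟨v, rfl⟩ : ∃ v, s = 2 * v := ⟨s / 2, by omega⟩
      rw [P_two_mul u (by omega), P_two_mul v (by omega)]
      exact ih u v d (by omega) (by omega) (by omega)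
    · obtain ⟨v, rfl⟩ : ∃ v, s = 2 * v + 1 := ⟨s / 2, by omega⟩
      rw [P_two_mul_add_one u (by omega), P_two_mul_add_one v (by omega),
        ih (u + 1) v (d + 1) (by omega) (by omega) (by omega),
        ih u (v + 1) (d - 1) (by omega) (by omega) (by omega),
        show -(d + 1) = -d - 1 by ring, show -(d - 1) = -d + 1 by ring, add_comm]

/-- Folding a word and its swap from dyadic reflections of each other keeps them so. -/
theorem P_foldl_reflect (w : List LR) : ∀ (k t s : ℕ) (d : ℤ), 2 ^ k < t → t < 2 ^ (k + 1) →
    t + s = 3 * 2 ^ k →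
    P (w.foldl LRstep t) d = P ((w.map swapLR).foldl LRstep s) (-d) := by
  induction w with
  | nil =>
    intro k t s d h1 h2 h3
    exact P_reflect_dyadic k t s d h1.le h2.le h3
  | cons a w ih =>
    intro k t s d h1 h2 h3
    rw [pow_succ] at h2
    cases a <;> simp only [List.map_cons, List.foldl_cons, swapLR, LRstep] <;>
      apply ih (k + 1) <;> simp only [pow_succ] <;> omega

/-- Reflection symmetry: `P_w(d) = P_{w̄}(-d)`, where `w̄` interchanges `L` and `R`. -/
theorem P_word_reflect (w : List LR) (d : ℤ) :
    P (hword w) d = P (hword (w.map swapLR)) (-d) := by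
  exact P_foldl_reflect w 1 3 3 d (by norm_num) (by norm_num) (by norm_num)
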